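/- arXiv:0712.0827 — 2 statements merged into one kernel-verified Lean document; each statement's English description precedes it below -/
import Mathlib

section
/- Let k ≥ 1 and n ≥ 1 be integers, let i be an integer with 0 ≤ i < k, and let d_0 ∈ (0, δ_{k,n}). Set c = h_{k,n}(d_0), d_i = C_{k,n}(i)·d_0, d_k = C_{k,n}(k)·d_0, and b_i = (16k(1 + 10·C_{k,n}(i)))^{-(n-1)}. Then d_0 + 10·d_i ≤ b_i·(c − 1 + d_0·(2 − i/k)). -/
/-- The constants `C_{k,n}(i)`, defined recursively by `C_{k,n}(0) = 1` and
`C_{k,n}(i) = (16k)^(n-1) * (1 + 10 C_{k,n}(i-1))^n + 3 + 10 C_{k,n}(i-1)`. -/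
def Ckn (k n : ℕ) : ℕ → ℝ
  | 0 => 1
  | i + 1 => (16 * k : ℝ) ^ (n - 1) * (1 + 10 * Ckn k n i) ^ n + 3 + 10 * Ckn k n i

/-- The function `h_{k,n}(x) = (1 - 10^(k+2) C_{k,n} x (1 + x/(2k))^k)⁻¹`. -/
noncomputable def hkn (k n : ℕ) (x : ℝ) : ℝ :=
  (1 - (10 : ℝ) ^ (k + 2) * Ckn k n k * x * (1 + x / (2 * k)) ^ k)⁻¹

theorem one_le_Ckn (k n i : ℕ) : 1 ≤ Ckn k n i := by
  induction i with
  | zero => simp [Ckn]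
  | succ i ih =>
    have : 0 ≤ (16 * k : ℝ) ^ (n - 1) * (1 + 10 * Ckn k n i) ^ n := by positivity
    rw [Ckn]
    linarith

theorem Ckn_monotone (k n : ℕ) : Monotone (Ckn k n) := by
  refine monotone_nat_of_le_succ fun i => ?_
  have h := one_le_Ckn k n i
  have : 0 ≤ (16 * k : ℝ) ^ (n - 1) * (1 + 10 * Ckn k n i) ^ n := by positivity
  rw [Ckn]
  linarith

/-- Below the pole `δ`, the function `h_{k,n}` satisfies `h_{k,n}(x) - 1 ≥ C_{k,n} x`. -/
theorem Ckn_mul_le_hkn_sub_one {k n : ℕ} {δ x : ℝ}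
    (hδ : (10 : ℝ) ^ (k + 2) * Ckn k n k * δ * (1 + δ / (2 * k)) ^ k = 1)
    (hx : 0 < x) (hxδ : x < δ) : Ckn k n k * x ≤ hkn k n x - 1 := by
  have hC := one_le_Ckn k n k
  have hC0 : 0 < Ckn k n k := by linarith
  have hX : (10 : ℝ) ^ (k + 2) * Ckn k n k * x * (1 + x / (2 * k)) ^ k < 1 := by
    have hδ0 : 0 < δ := hx.trans hxδ
    have hpow : (1 + x / (2 * k)) ^ k ≤ (1 + δ / (2 * k)) ^ k := by gcongr
    exact (mul_lt_mul (by gcongr) hpow (by positivity) (by positivity)).trans_eq hδ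
  have hlow : Ckn k n k * x ≤ (10 : ℝ) ^ (k + 2) * Ckn k n k * x * (1 + x / (2 * k)) ^ k := by
    have h1 : (1 : ℝ) ≤ 10 ^ (k + 2) := one_le_pow₀ (by norm_num)
    have h2 : 1 ≤ (1 + x / (2 * k)) ^ k :=
      one_le_pow₀ (le_add_of_nonneg_right (by positivity))
    calc Ckn k n k * x ≤ 10 ^ (k + 2) * (Ckn k n k * x) :=
          le_mul_of_one_le_left (by positivity) h1
      _ = 10 ^ (k + 2) * Ckn k n k * x := by ring
      _ ≤ _ := le_mul_of_one_le_right (by positivity) h2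
  rw [hkn]
  set X := (10 : ℝ) ^ (k + 2) * Ckn k n k * x * (1 + x / (2 * k)) ^ k
  have hinv : 1 + X ≤ (1 - X)⁻¹ := by
    rw [le_inv_comm₀ (by nlinarith [mul_pos hC0 hx]) (by linarith), inv_eq_one_div,
      le_div_iff₀ (by nlinarith [mul_pos hC0 hx])]
    nlinarith [sq_nonneg X]
  linarith

/-- for `0 ≤ i < k`, `d_0 ∈ (0, δ_{k,n})`, `c = h_{k,n}(d_0)`,
`d_i = C_{k,n}(i) d_0`, and `b_i = (16k(1 + 10 C_{k,n}(i)))^{-(n-1)}`, one has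
`d_0 + 10 d_i ≤ b_i (c - 1 + d_0 (2 - i/k))`. -/
theorem di_bi_inequality (k n : ℕ) (hk : 1 ≤ k) (hn : 1 ≤ n)
    (i : ℕ) (hi : i < k)
    (δ : ℝ) (hδ : 0 < δ)
    (hδeq : (10 : ℝ) ^ (k + 2) * Ckn k n k * δ * (1 + δ / (2 * k)) ^ k = 1)
    (d₀ : ℝ) (hd₀ : d₀ ∈ Set.Ioo (0 : ℝ) δ)
    (c di dk bi : ℝ)
    (hc : c = hkn k n d₀)
    (hdi : di = Ckn k n i * d₀)
    (hdk : dk = Ckn k n k * d₀)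
    (hbi : bi = ((16 * k * (1 + 10 * Ckn k n i) : ℝ) ^ (n - 1))⁻¹) :
    d₀ + 10 * di ≤ bi * (c - 1 + d₀ * (2 - (i : ℝ) / k)) := by
  obtain ⟨hd, hdδ⟩ := hd₀
  have hk0 : (0 : ℝ) < k := by exact_mod_cast hk
  have hC := one_le_Ckn k n i
  have hh := Ckn_mul_le_hkn_sub_one hδeq hd hdδ
  have hstep : (16 * k : ℝ) ^ (n - 1) * (1 + 10 * Ckn k n i) ^ n ≤ Ckn k n k := by
    have h : Ckn k n (i + 1) ≤ Ckn k n k := Ckn_monotone k n hi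
    rw [Ckn] at h
    linarith
  have hik : (i : ℝ) / k ≤ 1 := by
    rw [div_le_one hk0]
    exact_mod_cast hi.le
  have hbase : 0 < (16 * k * (1 + 10 * Ckn k n i) : ℝ) ^ (n - 1) := by positivity
  subst hc hdi hbi
  rw [inv_mul_eq_div, le_div_iff₀ hbase]
  calc (d₀ + 10 * (Ckn k n i * d₀)) * (16 * k * (1 + 10 * Ckn k n i)) ^ (n - 1)
      = (16 * k : ℝ) ^ (n - 1) * (1 + 10 * Ckn k n i) ^ n * d₀ := by
        obtain ⟨m, rfl⟩ := Nat.exists_eq_add_of_le' hn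
        rw [Nat.add_sub_cancel, mul_pow, pow_succ (1 + 10 * Ckn k (m + 1) i)]
        ring
    _ ≤ Ckn k n k * d₀ := by gcongr
    _ ≤ hkn k n d₀ - 1 := hh
    _ ≤ _ := le_add_of_nonneg_right (mul_nonneg hd.le (by linarith))
end

section
/- Let k ≥ 1 and n ≥ 2 be integers and d_0 > 0 a real number. Suppose (d_i)_{i≥0} and (b_i)_{i≥0} are sequences of positive real numbers, with d_0 equal to the given value, satisfying for all i ≥ 0 the two inequalities d_0 + 10·d_i ≤ b_i·(d_{i+1} − 3·d_0 − 10·d_i) and 8·b_i^{1/(n-1)}·(d_0 + 10·d_i) ≤ d_0/(2k). Then for all i ≥ 0, d_i ≥ C_{k,n}(i)·d_0 and b_i ≤ (16k(1 + 10·C_{k,n}(i)))^{-(n-1)}. -/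
theorem Ckn_pos (k n i : ℕ) : 0 < Ckn k n i := by
  induction i with
  | zero => simp [Ckn]
  | succ i ih => rw [Ckn]; positivity

/-- A bound on `a ^ (1 / (n - 1))` relative to `y / x` yields a bound on `a`, for any lower bound
`c * y` of `x`. -/
theorem le_inv_pow_of_rpow_mul_le {k n : ℕ} (hk : 1 ≤ k) (hn : 2 ≤ n) {a c x y : ℝ}
    (ha : 0 < a) (hc : 0 < c) (hy : 0 < y) (hx : c * y ≤ x)
    (h : 8 * a ^ ((1 : ℝ) / (n - 1)) * x ≤ y / (2 * k)) :
    a ≤ ((16 * k * c : ℝ) ^ (n - 1))⁻¹ := by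
  have hk' : (0 : ℝ) < k := by exact_mod_cast hk
  have hroot : (a ^ ((1 : ℝ) / (n - 1))) ^ (n - 1) = a := by
    have hcast : ((n : ℝ) - 1) = ((n - 1 : ℕ) : ℝ) := by
      rw [Nat.cast_sub (by omega), Nat.cast_one]
    rw [hcast, one_div, Real.rpow_inv_natCast_pow ha.le (by omega)]
  set r := a ^ ((1 : ℝ) / (n - 1))
  have hr : 0 < r := Real.rpow_pos_of_pos ha _
  rw [le_div_iff₀ (by positivity)] at h
  have hle : r ≤ (16 * k * c : ℝ)⁻¹ := by
    rw [← one_div, le_div_iff₀ (by positivity)]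
    refine le_of_mul_le_mul_right ?_ hy
    calc r * (16 * k * c) * y = 8 * r * (c * y) * (2 * k) := by ring
      _ ≤ 8 * r * x * (2 * k) := by gcongr
      _ ≤ 1 * y := by rwa [one_mul]
  rw [← hroot, ← inv_pow]
  gcongr

/-- if positive sequences `d_i`, `b_i` satisfy, for all `i ≥ 0`,
`d_0 + 10 d_i ≤ b_i (d_{i+1} - 3 d_0 - 10 d_i)` and
`8 b_i^{1/(n-1)} (d_0 + 10 d_i) ≤ d_0/(2k)`, then
`d_i ≥ C_{k,n}(i) d_0` and `b_i ≤ (16k(1 + 10 C_{k,n}(i)))^{-(n-1)}` for all `i`. -/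
theorem di_bi_optimality (k n : ℕ) (hk : 1 ≤ k) (hn : 2 ≤ n)
    (d b : ℕ → ℝ) (hdpos : ∀ i, 0 < d i) (hbpos : ∀ i, 0 < b i)
    (h1 : ∀ i, d 0 + 10 * d i ≤ b i * (d (i + 1) - 3 * d 0 - 10 * d i))
    (h3 : ∀ i, 8 * b i ^ ((1 : ℝ) / (n - 1)) * (d 0 + 10 * d i) ≤ d 0 / (2 * k)) :
    ∀ i : ℕ, Ckn k n i * d 0 ≤ d i ∧
      b i ≤ ((16 * k * (1 + 10 * Ckn k n i) : ℝ) ^ (n - 1))⁻¹ := by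
  have hb : ∀ i, Ckn k n i * d 0 ≤ d i →
      b i ≤ ((16 * k * (1 + 10 * Ckn k n i) : ℝ) ^ (n - 1))⁻¹ := fun i hi ↦
    le_inv_pow_of_rpow_mul_le hk hn (hbpos i) (by linarith [Ckn_pos k n i]) (hdpos 0)
      (by linarith) (h3 i)
  suffices hd : ∀ i, Ckn k n i * d 0 ≤ d i from fun i ↦ ⟨hd i, hb i (hd i)⟩
  intro i
  induction i with
  | zero => simp [Ckn]
  | succ i ih =>
    have hC := Ckn_pos k n i
    have hk' : (0 : ℝ) < k := by exact_mod_cast hk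
    have hbi := hb i ih
    have h1i := h1 i
    have hdi := hdpos i
    have hd0 := hdpos 0
    have hE : 0 < d (i + 1) - 3 * d 0 - 10 * d i :=
      pos_of_mul_pos_right (by linarith) (hbpos i).le
    have hstep := h1i.trans (mul_le_mul_of_nonneg_right hbi hE.le)
    rw [inv_mul_eq_div, le_div_iff₀ (by positivity)] at hstep
    have hpow : (1 + 10 * Ckn k n i) * d 0 * (16 * k * (1 + 10 * Ckn k n i)) ^ (n - 1) =
        (16 * k : ℝ) ^ (n - 1) * (1 + 10 * Ckn k n i) ^ n * d 0 := by
      obtain ⟨m, rfl⟩ : ∃ m, n = m + 1 := ⟨n - 1, by omega⟩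
      rw [Nat.add_sub_cancel, mul_pow, pow_succ]
      ring
    have hmono : (1 + 10 * Ckn k n i) * d 0 * (16 * k * (1 + 10 * Ckn k n i)) ^ (n - 1) ≤
        (d 0 + 10 * d i) * (16 * k * (1 + 10 * Ckn k n i)) ^ (n - 1) :=
      mul_le_mul_of_nonneg_right (by linarith) (by positivity)
    rw [Ckn]
    linarith
end
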